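/- (Classification of SL(2,k)-orbits of binary cubics with square discriminant) Let P = λ₁φ₁³ + λ₂φ₂³ and P' = λ₁'φ₁'³ + λ₂'φ₂'³ be binary cubics over k, where λ₁, λ₂, λ₁', λ₂' ∈ k*, and φ₁, φ₂ and φ₁', φ₂' are linear forms with Ω(φ₁,φ₂) ≠ 0 and Ω(φ₁',φ₂') ≠ 0. Set q = λ₁λ₂·Ω(φ₁,φ₂)³ and q' = λ₁'λ₂'·Ω(φ₁',φ₂')³. Then there exists g ∈ SL(2,k) with g·P = P' if and only if either (q' = q and λ₁λ₂'·(λ₂λ₁')⁻¹ is a cube in k*) or (q' = −q and λ₁λ₁'·(λ₂λ₂')⁻¹ is a cube in k*). -/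

import Mathlib

open MvPolynomial

/-- A binary cubic `a·x³ + 3b·x²y + 3c·xy² + d·y³`, recorded by its coefficients. -/
structure BinCubic (k : Type*) where
  a : k
  b : k
  c : k
  d : k

namespace BinCubic

variable {k : Type*} [Field k]

instance : Zero (BinCubic k) := ⟨⟨0, 0, 0, 0⟩⟩

instance : Add (BinCubic k) :=
  ⟨fun P Q => ⟨P.a + Q.a, P.b + Q.b, P.c + Q.c, P.d + Q.d⟩⟩

instance : Neg (BinCubic k) := ⟨fun P => ⟨-P.a, -P.b, -P.c, -P.d⟩⟩

instance : Sub (BinCubic k) :=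
  ⟨fun P Q => ⟨P.a - Q.a, P.b - Q.b, P.c - Q.c, P.d - Q.d⟩⟩

instance : SMul k (BinCubic k) := ⟨fun t P => ⟨t * P.a, t * P.b, t * P.c, t * P.d⟩⟩

/-- The homogeneous cubic polynomial in `k[x,y]` attached to a binary cubic. -/
noncomputable def toPoly (P : BinCubic k) : MvPolynomial (Fin 2) k :=
  C P.a * X 0 ^ 3 + C (3 * P.b) * X 0 ^ 2 * X 1 +
    C (3 * P.c) * X 0 * X 1 ^ 2 + C P.d * X 1 ^ 3

/-- The linear form `e·x + f·y`. -/
noncomputable def lin (e f : k) : MvPolynomial (Fin 2) k := C e * X 0 + C f * X 1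

/-- A binary quadratic `u·x² + v·xy + w·y²`. -/
noncomputable def quadPoly (u v w : k) : MvPolynomial (Fin 2) k :=
  C u * X 0 ^ 2 + C v * (X 0 * X 1) + C w * X 1 ^ 2

/-- The moment map `μ`. -/
def mu (P : BinCubic k) : Matrix (Fin 2) (Fin 2) k :=
  !![P.a * P.d - P.b * P.c, 2 * (P.b * P.d - P.c ^ 2);
     2 * (P.b ^ 2 - P.a * P.c), -(P.a * P.d - P.b * P.c)]

/-- The normalized quartic invariant `Q_n`. -/
def Qn (P : BinCubic k) : k :=
  P.a ^ 2 * P.d ^ 2 - 3 * P.b ^ 2 * P.c ^ 2 - 6 * P.a * P.b * P.c * P.d +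
    4 * P.b ^ 3 * P.d + 4 * P.a * P.c ^ 3

/-- The derivation action of the trace-free matrix `M = [[α,β],[γ,−α]]` on binary cubics,
induced by `M·x = −αx − βy`, `M·y = −γx + αy`.  Explicitly,
`M·P = (−3aα−3bγ)x³ + (−3aβ−3bα−6cγ)x²y + (−6bβ+3cα−3dγ)xy² + (−3cβ+3dα)y³`. -/
def matAct (M : Matrix (Fin 2) (Fin 2) k) (P : BinCubic k) : BinCubic k :=
  ⟨-(3 * P.a * M 0 0) - 3 * P.b * M 1 0,
   -(P.a * M 0 1) - P.b * M 0 0 - 2 * P.c * M 1 0,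
   -(2 * P.b * M 0 1) + P.c * M 0 0 - P.d * M 1 0,
   -(3 * P.c * M 0 1) + 3 * P.d * M 0 0⟩

/-- The cubic covariant `Ψ(P) = μ(P)·P`. -/
def Psi (P : BinCubic k) : BinCubic k := matAct (mu P) P

/-- The symplectic form `ω` on binary cubics. -/
def omega (P Q : BinCubic k) : k :=
  P.a * Q.d - P.d * Q.a - 3 * P.b * Q.c + 3 * P.c * Q.b

/-- `λ·(ex+fy)³` as a binary cubic. -/
def cubeForm (lam e f : k) : BinCubic k :=
  ⟨lam * e ^ 3, lam * e ^ 2 * f, lam * e * f ^ 2, lam * f ^ 3⟩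

/-- The action on binary cubics of the algebra substitution `x ↦ px + qy`, `y ↦ rx + sy`. -/
def substAct (p q r s : k) (P : BinCubic k) : BinCubic k :=
  ⟨P.a * p ^ 3 + 3 * P.b * p ^ 2 * r + 3 * P.c * p * r ^ 2 + P.d * r ^ 3,
   P.a * p ^ 2 * q + P.b * (p ^ 2 * s + 2 * p * q * r) + P.c * (2 * p * r * s + q * r ^ 2) +
     P.d * r ^ 2 * s,
   P.a * p * q ^ 2 + P.b * (2 * p * q * s + q ^ 2 * r) + P.c * (p * s ^ 2 + 2 * q * r * s) +
     P.d * r * s ^ 2,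
   P.a * q ^ 3 + 3 * P.b * q ^ 2 * s + 3 * P.c * q * s ^ 2 + P.d * s ^ 3⟩

/-- `M^{⊗3}` acting on binary cubics for a trace-free `M = [[α,β],[γ,−α]]`: the algebra
substitution `x ↦ −αx − βy`, `y ↦ −γx + αy`; it sends `φ³` to `(M·φ)³` for linear forms `φ`. -/
def tensorCubeAct (M : Matrix (Fin 2) (Fin 2) k) (P : BinCubic k) : BinCubic k :=
  substAct (-(M 0 0)) (-(M 0 1)) (-(M 1 0)) (M 0 0) P

/-- Action of a trace-free matrix `M = [[α,β],[γ,−α]]` on the linear form `ex + fy`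
(`M·x = −αx − βy`, `M·y = −γx + αy`), recorded by the resulting pair of coefficients. -/
def linAct (M : Matrix (Fin 2) (Fin 2) k) (e f : k) : k × k :=
  (-(e * M 0 0) - f * M 1 0, -(e * M 0 1) + f * M 0 0)

/-- Evaluation of `P` at the point `(u, w) ∈ k²`. -/
def evalAt (P : BinCubic k) (u w : k) : k :=
  P.a * u ^ 3 + 3 * P.b * u ^ 2 * w + 3 * P.c * u * w ^ 2 + P.d * w ^ 3

/-- The symplectic form `Ω` on `k²`. -/
def Omeg (v w : Fin 2 → k) : k := v 0 * w 1 - v 1 * w 0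

/-- The action of `g = [[α,β],[γ,δ]]` on polynomials by the algebra substitution
`g·x = δx − βy`, `g·y = −γx + αy`. -/
noncomputable def slAct (g : Matrix (Fin 2) (Fin 2) k) (P : MvPolynomial (Fin 2) k) :
    MvPolynomial (Fin 2) k :=
  aeval ![C (g 1 1) * X 0 - C (g 0 1) * X 1, C (g 0 0) * X 1 - C (g 1 0) * X 0] P

/-- The symmetric bilinear polarization `B_μ` of the moment map: `B_μ(P,P) = μ(P)`. -/
def Bmu (P Q : BinCubic k) : Matrix (Fin 2) (Fin 2) k :=
  !![(P.a * Q.d + P.d * Q.a - P.b * Q.c - P.c * Q.b) / 2,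
       (P.b * Q.d + P.d * Q.b) - P.c * Q.c;
     P.b * Q.b - (P.a * Q.c + P.c * Q.a),
       -((P.a * Q.d + P.d * Q.a - P.b * Q.c - P.c * Q.b) / 2)]

/-- `P` is reducible over `k`: it factors as (nonzero linear form)·(binary quadratic). -/
def IsReducible (P : BinCubic k) : Prop :=
  ∃ e f u v w : k, (e ≠ 0 ∨ f ≠ 0) ∧ toPoly P = lin e f * quadPoly u v w

end BinCubic

open BinCubic
namespace BinCubic

@[ext]
theorem ext_coeff {k : Type*} {P Q : BinCubic k} (ha : P.a = Q.a) (hb : P.b = Q.b) (hc : P.c = Q.c)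
    (hd : P.d = Q.d) : P = Q := by
  cases P
  cases Q
  simp_all

variable {k : Type*} [Field k]

@[simp] theorem add_a (P Q : BinCubic k) : (P + Q).a = P.a + Q.a := rfl

@[simp] theorem add_b (P Q : BinCubic k) : (P + Q).b = P.b + Q.b := rfl

@[simp] theorem add_c (P Q : BinCubic k) : (P + Q).c = P.c + Q.c := rfl

@[simp] theorem add_d (P Q : BinCubic k) : (P + Q).d = P.d + Q.d := rfl

theorem add_comm' (P Q : BinCubic k) : P + Q = Q + P := by
  ext <;> simp [add_comm]

theorem slAct_toPoly (g : Matrix (Fin 2) (Fin 2) k) (P : BinCubic k) :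
    slAct g (toPoly P) = toPoly (substAct (g 1 1) (-(g 0 1)) (-(g 1 0)) (g 0 0) P) := by
  simp only [slAct, toPoly, substAct, map_add, map_mul, map_pow, map_neg, aeval_X, aeval_C,
    algebraMap_eq, map_ofNat, Matrix.cons_val_zero, Matrix.cons_val_one]
  ring

theorem eval_toPoly (P : BinCubic k) (u w : k) :
    eval ![u, w] (toPoly P) = evalAt P u w := by
  simp [toPoly, evalAt]

theorem toPoly_injective (h2 : (2 : k) ≠ 0) (h3 : (3 : k) ≠ 0) :
    Function.Injective (toPoly : BinCubic k → MvPolynomial (Fin 2) k) := by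
  intro P Q h
  have key (u w : k) : evalAt P u w = evalAt Q u w := by
    rw [← eval_toPoly, ← eval_toPoly, h]
  have h10 := key 1 0
  have h01 := key 0 1
  have h11 := key 1 1
  have h1n := key 1 (-1)
  simp only [evalAt] at h10 h01 h11 h1n
  have ha : P.a = Q.a := by linear_combination h10
  have hd : P.d = Q.d := by linear_combination h01
  refine ext_coeff ha ?_ ?_ hd
  · apply mul_left_cancel₀ (mul_ne_zero h2 h3)
    linear_combination h11 - h1n - 2 * hd
  · apply mul_left_cancel₀ (mul_ne_zero h2 h3)
    linear_combination h11 + h1n - 2 * ha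

theorem substAct_add (p q r s : k) (P Q : BinCubic k) :
    substAct p q r s (P + Q) = substAct p q r s P + substAct p q r s Q := by
  ext <;> simp [substAct] <;> ring

theorem substAct_cubeForm (p q r s l e f : k) :
    substAct p q r s (cubeForm l e f) = cubeForm l (e * p + f * r) (e * q + f * s) := by
  ext <;> simp [substAct, cubeForm] <;> ring

theorem cubeForm_smul (l u e f : k) :
    cubeForm l (u * e) (u * f) = cubeForm (l * u ^ 3) e f := by
  ext <;> simp [cubeForm] <;> ring

/-- If two independent vectors `(A, B)`, `(C, D)` satisfy the vanishing of the mixed coefficients of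
`l₁(AX + BY)³ + l₂(CX + DY)³`, then they are multiples of the coordinate vectors, up to order. -/
theorem diagonal_or_antidiagonal {l1 l2 A B C D : k} (hl1 : l1 ≠ 0) (hl2 : l2 ≠ 0)
    (hdet : A * D - B * C ≠ 0) (hb : l1 * A ^ 2 * B + l2 * C ^ 2 * D = 0)
    (hc : l1 * A * B ^ 2 + l2 * C * D ^ 2 = 0) : (B = 0 ∧ C = 0) ∨ (A = 0 ∧ D = 0) := by
  have hAB : A * B = 0 := by
    have h : (l1 * (A * D - B * C)) * (A * B) = 0 := by linear_combination D * hb - C * hc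
    exact (mul_eq_zero.1 h).resolve_left (mul_ne_zero hl1 hdet)
  have hCD : C * D = 0 := by
    have h : (l2 * (A * D - B * C)) * (C * D) = 0 := by linear_combination A * hc - B * hb
    exact (mul_eq_zero.1 h).resolve_left (mul_ne_zero hl2 hdet)
  rcases mul_eq_zero.1 hAB with rfl | rfl <;> rcases mul_eq_zero.1 hCD with rfl | rfl <;> simp_all

/-- The decomposition of a binary cubic as a sum of two cubes of independent linear forms is unique
up to order and scaling. -/
theorem exists_scaling_of_cubeForm_add_eq {l1 l2 m1 m2 p1 q1 p2 q2 e1 f1 e2 f2 : k}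
    (hl1 : l1 ≠ 0) (hl2 : l2 ≠ 0)
    (hpq : p1 * q2 - q1 * p2 ≠ 0) (hef : e1 * f2 - f1 * e2 ≠ 0)
    (h : cubeForm l1 p1 q1 + cubeForm l2 p2 q2 = cubeForm m1 e1 f1 + cubeForm m2 e2 f2) :
    (∃ u v, p1 * q2 - q1 * p2 = u * v * (e1 * f2 - f1 * e2) ∧ m1 = l1 * u ^ 3 ∧
        m2 = l2 * v ^ 3) ∨
      ∃ u v, p1 * q2 - q1 * p2 = -(u * v * (e1 * f2 - f1 * e2)) ∧ m2 = l1 * u ^ 3 ∧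
        m1 = l2 * v ^ 3 := by
  have coords (p q : k) : ∃ A B, p = A * e1 + B * e2 ∧ q = A * f1 + B * f2 := by
    refine ⟨(p * f2 - q * e2) / (e1 * f2 - f1 * e2), (e1 * q - f1 * p) / (e1 * f2 - f1 * e2),
      ?_, ?_⟩ <;>
    rw [div_mul_eq_mul_div, div_mul_eq_mul_div, ← add_div, eq_div_iff hef] <;> ring
  obtain ⟨A, B, rfl, rfl⟩ := coords p1 q1
  obtain ⟨C, D, rfl, rfl⟩ := coords p2 q2
  have ha := congrArg BinCubic.a h
  have hb := congrArg BinCubic.b h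
  have hc := congrArg BinCubic.c h
  have hd := congrArg BinCubic.d h
  simp only [cubeForm, add_a, add_b, add_c, add_d] at ha hb hc hd
  have hdet : A * D - B * C ≠ 0 := by
    intro h0
    apply hpq
    linear_combination (e1 * f2 - f1 * e2) * h0
  have hw := pow_ne_zero 3 hef
  have hX : l1 * A ^ 3 + l2 * C ^ 3 = m1 := by
    apply mul_left_cancel₀ hw
    linear_combination f2 ^ 3 * ha - 3 * f2 ^ 2 * e2 * hb + 3 * f2 * e2 ^ 2 * hc - e2 ^ 3 * hd
  have hY : l1 * B ^ 3 + l2 * D ^ 3 = m2 := by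
    apply mul_left_cancel₀ hw
    linear_combination -f1 ^ 3 * ha + 3 * f1 ^ 2 * e1 * hb - 3 * f1 * e1 ^ 2 * hc + e1 ^ 3 * hd
  have hXXY : l1 * A ^ 2 * B + l2 * C ^ 2 * D = 0 := by
    apply mul_left_cancel₀ hw
    linear_combination -f2 ^ 2 * f1 * ha + (f2 ^ 2 * e1 + 2 * f2 * e2 * f1) * hb -
      (e2 ^ 2 * f1 + 2 * f2 * e2 * e1) * hc + e2 ^ 2 * e1 * hd
  have hXYY : l1 * A * B ^ 2 + l2 * C * D ^ 2 = 0 := by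
    apply mul_left_cancel₀ hw
    linear_combination f1 ^ 2 * f2 * ha - (f1 ^ 2 * e2 + 2 * f1 * e1 * f2) * hb +
      (e1 ^ 2 * f2 + 2 * f1 * e1 * e2) * hc - e1 ^ 2 * e2 * hd
  rcases diagonal_or_antidiagonal hl1 hl2 hdet hXXY hXYY with ⟨rfl, rfl⟩ | ⟨rfl, rfl⟩
  · exact Or.inl ⟨A, D, by ring, by linear_combination -hX, by linear_combination -hY⟩
  · exact Or.inr ⟨B, C, by ring, by linear_combination -hY, by linear_combination -hX⟩

/-- `SL(2,k)` moves a pair of independent linear forms to any pair with the same value of `Ω`. -/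
theorem exists_slAct_cubeForm_add (l1 l2 : k) {e1 f1 e2 f2 p1 q1 p2 q2 : k}
    (hef : e1 * f2 - f1 * e2 ≠ 0) (h : p1 * q2 - q1 * p2 = e1 * f2 - f1 * e2) :
    ∃ g : Matrix.SpecialLinearGroup (Fin 2) k,
      slAct (↑g) (toPoly (cubeForm l1 e1 f1 + cubeForm l2 e2 f2)) =
        toPoly (cubeForm l1 p1 q1 + cubeForm l2 p2 q2) := by
  set w := e1 * f2 - f1 * e2 with hw
  refine ⟨⟨!![(e1 * q2 - e2 * q1) / w, -((f2 * q1 - f1 * q2) / w);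
    -((e1 * p2 - e2 * p1) / w), (f2 * p1 - f1 * p2) / w], ?_⟩, ?_⟩
  · rw [Matrix.det_fin_two_of]
    field_simp
    linear_combination w * h - (p1 * q2 - q1 * p2) * hw
  · rw [slAct_toPoly, substAct_add, substAct_cubeForm, substAct_cubeForm]
    simp only [Matrix.of_apply, Matrix.cons_val', Matrix.cons_val_zero, Matrix.cons_val_one,
      Matrix.cons_val_fin_one, neg_neg]
    congr 3 <;> field_simp <;> rw [hw] <;> ring

/-- Equality of `q`-invariants and a cube ratio make two sums of two cubes equivalent. -/
theorem exists_slAct_of_cube_ratio {l1 l2 m1 m2 e1 f1 e2 f2 p1 q1 p2 q2 r : k}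
    (hl1 : l1 ≠ 0) (hl2 : l2 ≠ 0) (hm1 : m1 ≠ 0)
    (hef : e1 * f2 - f1 * e2 ≠ 0)
    (hq : m1 * m2 * (p1 * q2 - q1 * p2) ^ 3 = l1 * l2 * (e1 * f2 - f1 * e2) ^ 3)
    (hcube : l1 * m2 * (l2 * m1)⁻¹ = r ^ 3) :
    ∃ g : Matrix.SpecialLinearGroup (Fin 2) k,
      slAct (↑g) (toPoly (cubeForm l1 e1 f1 + cubeForm l2 e2 f2)) =
        toPoly (cubeForm m1 p1 q1 + cubeForm m2 p2 q2) := by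
  set w := e1 * f2 - f1 * e2 with hw
  set w' := p1 * q2 - q1 * p2 with hw'
  have hm2 : l1 * m2 = r ^ 3 * (l2 * m1) := by
    rw [← hcube]
    field_simp
  have hsq : m1 ^ 2 * (r * w') ^ 3 = l1 ^ 2 * w ^ 3 := by
    apply mul_left_cancel₀ hl2
    linear_combination l1 * hq - m1 * w' ^ 3 * hm2
  -- a square root of `w / (r * w')` whose cube is `m1 / l1`
  obtain ⟨u, hu2, hu3⟩ : ∃ u, u ^ 2 * (r * w') = w ∧ l1 * u ^ 3 = m1 := by
    refine ⟨m1 * (r * w') / (l1 * w), ?_, ?_⟩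
    · field_simp
      linear_combination hsq
    · field_simp
      linear_combination hsq
  have hv3 : l2 * (r * u) ^ 3 = m2 := by
    apply mul_left_cancel₀ hl1
    linear_combination r ^ 3 * l2 * hu3 - hm2
  rw [← hu3, ← hv3, ← cubeForm_smul, ← cubeForm_smul]
  apply exists_slAct_cubeForm_add l1 l2 hef
  linear_combination hu2 - u ^ 2 * r * hw'

end BinCubic

/-- classification of `SL(2,k)`-orbits of binary cubics with square
discriminant, written as `P = λ₁φ₁³ + λ₂φ₂³` with `q = λ₁λ₂Ω(φ₁,φ₂)³`. -/
theorem stmt16 {k : Type*} [Field k] (h2 : (2 : k) ≠ 0) (h3 : (3 : k) ≠ 0)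
    (lam1 lam2 lam1' lam2' e1 f1 e2 f2 e1' f1' e2' f2' : k)
    (hl1 : lam1 ≠ 0) (hl2 : lam2 ≠ 0) (hl1' : lam1' ≠ 0) (hl2' : lam2' ≠ 0)
    (hphi : e1 * f2 - f1 * e2 ≠ 0) (hphi' : e1' * f2' - f1' * e2' ≠ 0) :
    (∃ g : Matrix.SpecialLinearGroup (Fin 2) k,
        slAct (↑g) (toPoly (cubeForm lam1 e1 f1 + cubeForm lam2 e2 f2)) =
          toPoly (cubeForm lam1' e1' f1' + cubeForm lam2' e2' f2')) ↔
      ((lam1' * lam2' * (e1' * f2' - f1' * e2') ^ 3 =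
          lam1 * lam2 * (e1 * f2 - f1 * e2) ^ 3 ∧
          ∃ r : k, r ≠ 0 ∧ lam1 * lam2' * (lam2 * lam1')⁻¹ = r ^ 3) ∨
        (lam1' * lam2' * (e1' * f2' - f1' * e2') ^ 3 =
          -(lam1 * lam2 * (e1 * f2 - f1 * e2) ^ 3) ∧
          ∃ r : k, r ≠ 0 ∧ lam1 * lam1' * (lam2 * lam2')⁻¹ = r ^ 3)) := by
  constructor
  · rintro ⟨g, hg⟩
    have hdet := g.det_coe
    rw [Matrix.det_fin_two] at hdet
    rw [slAct_toPoly, substAct_add, substAct_cubeForm, substAct_cubeForm] at hg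
    have hΩ : (e1 * g 1 1 + f1 * -g 1 0) * (e2 * -g 0 1 + f2 * g 0 0) -
        (e1 * -g 0 1 + f1 * g 0 0) * (e2 * g 1 1 + f2 * -g 1 0) = e1 * f2 - f1 * e2 := by
      linear_combination (e1 * f2 - f1 * e2) * hdet
    rcases exists_scaling_of_cubeForm_add_eq hl1 hl2 (hΩ ▸ hphi) hphi'
      (toPoly_injective h2 h3 hg) with ⟨u, v, huv, rfl, rfl⟩ | ⟨u, v, huv, rfl, rfl⟩
    all_goals
      have hu : u ≠ 0 := by
        rintro rfl
        simp at hl1' hl2'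
      have hv : v ≠ 0 := by
        rintro rfl
        simp at hl1' hl2'
      rw [hΩ] at huv
      rw [huv]
    · refine Or.inl ⟨by ring, v / u, div_ne_zero hv hu, ?_⟩
      field_simp
    · refine Or.inr ⟨by ring, v / u, div_ne_zero hv hu, ?_⟩
      field_simp
  · rintro (⟨hq, r, -, hcube⟩ | ⟨hq, r, -, hcube⟩)
    · exact exists_slAct_of_cube_ratio hl1 hl2 hl1' hphi hq hcube
    · rw [add_comm' (cubeForm lam1' e1' f1')]
      refine exists_slAct_of_cube_ratio hl1 hl2 hl2' hphi ?_ hcube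
      linear_combination -hq
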